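/- arXiv:2202.00911 — 4 statements merged into one kernel-verified Lean document; each statement's English description precedes it below -/
import Mathlib

section
/- Let M be a positive integer, ν ∈ ℝ^M a nonzero vector, and let N, N̲ be real numbers with N̲ ≥ 1 and N ≥ 2 M N̲. For each m ∈ {1,…,M} define n_m := max{ (N − M N̲) · ν(m)² / ‖ν‖₂² , N̲ }. Then for every γ ∈ [0,1], ∑_{m=1}^{M} ν(m)²/n_m ≤ (2‖ν‖₂²/N) · ( (1−γ)‖ν‖_{0,γ} + γ M ), where ‖ν‖_{0,γ} := #{ m : ν(m)² > γ ‖ν‖₂²/N }. -/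
open Finset

/-- Allocating at least half of the budget `N` proportionally to `a / S` costs at most `2S/N`
per unit task. -/
lemma div_max_le_two_mul_div {a S N K L : ℝ} (ha : 0 ≤ a) (hS : 0 < S) (hN : 0 < N)
    (hL : 0 < L) (hK : N / 2 ≤ K) : a / max (K * a / S) L ≤ 2 * S / N := by
  rw [div_le_iff₀ (lt_max_of_lt_right hL)]
  calc a = 2 * S / N * (N / 2 * a / S) := by field_simp
    _ ≤ 2 * S / N * (K * a / S) := by gcongr
    _ ≤ 2 * S / N * max (K * a / S) L := by gcongr; exact le_max_left _ _

/-- A task below the threshold `γ S / N` costs at most twice that threshold. -/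
lemma div_max_le_of_le_threshold {a S N L x γ : ℝ} (ha : 0 ≤ a) (hL : 1 ≤ L)
    (h : a ≤ γ * S / N) : a / max x L ≤ 2 * S / N * γ := by
  have h₁ : a / max x L ≤ a := div_le_self ha (hL.trans (le_max_right _ _))
  have h₂ : 2 * S / N * γ = 2 * (γ * S / N) := by ring
  linarith

/-- deterministic decomposition bound for the known-`ν*` sampling
scheme. With `n_m = max{(N − M N̲) ν(m)²/‖ν‖₂², N̲}`, for every `γ ∈ [0,1]`,
`∑ ν(m)²/n_m ≤ (2‖ν‖₂²/N)((1−γ)‖ν‖_{0,γ} + γ M)`. -/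
theorem known_nu_sampling_bound
    (M : ℕ) (hM : 0 < M)
    (ν : Fin M → ℝ) (hν : ν ≠ 0)
    (N Nlow : ℝ) (hNlow : 1 ≤ Nlow) (hN : 2 * M * Nlow ≤ N) :
    let S : ℝ := ∑ m, (ν m) ^ 2
    let n : Fin M → ℝ := fun m => max ((N - M * Nlow) * (ν m) ^ 2 / S) Nlow
    ∀ γ : ℝ, γ ∈ Set.Icc (0 : ℝ) 1 →
      ∑ m, (ν m) ^ 2 / n m ≤
        (2 * S / N) *
          ((1 - γ) * ((univ.filter (fun m => (ν m) ^ 2 > γ * S / N)).card : ℝ)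
            + γ * M) := by
  intro S n γ hγ
  have hS : 0 < S := by
    obtain ⟨i, hi⟩ := Function.ne_iff.mp hν
    exact sum_pos' (fun m _ => sq_nonneg (ν m)) ⟨i, mem_univ i, by simpa using sq_pos_of_ne_zero hi⟩
  have hNpos : 0 < N := by
    have : (0 : ℝ) < M := by exact_mod_cast hM
    have : 0 < 2 * M * Nlow := by positivity
    linarith
  have key (m : Fin M) : (ν m) ^ 2 / n m ≤
      2 * S / N * ((1 - γ) * (if (ν m) ^ 2 > γ * S / N then 1 else 0) + γ) := by
    split_ifs with h
    · have := div_max_le_two_mul_div (K := N - M * Nlow) (L := Nlow) (sq_nonneg (ν m)) hS hNpos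
        (by linarith) (by linarith)
      simpa using this
    · have := div_max_le_of_le_threshold (x := (N - M * Nlow) * (ν m) ^ 2 / S)
        (sq_nonneg (ν m)) hNlow (not_lt.mp h)
      simpa using this
  refine (sum_le_sum fun m _ => key m).trans_eq ?_
  rw [← mul_sum, sum_add_distrib, ← mul_sum, sum_boole]
  simp [mul_comm]
end

section
/- Let d, K, M be positive integers, let B ∈ ℝ^{d×K} satisfy Bᵀ B = I_K, let W ∈ ℝ^{K×M} be such that W Wᵀ is invertible, and let Δ ∈ ℝ^{d×M} be arbitrary. Set A := B W and P := B (W Wᵀ)⁻¹ Bᵀ. Then ‖ P (Δ Δᵀ + Δ Aᵀ + A Δᵀ) P ‖_F ≤ ‖(W Wᵀ)⁻¹‖_F² · ‖Δ‖_F² + 2 · ‖Wᵀ (W Wᵀ)⁻¹‖_F · ‖(W Wᵀ)⁻¹‖_F · ‖Δ‖_F. -/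
open Matrix

section FrobeniusNorm

open scoped Matrix.Norms.Frobenius

variable {m n k : Type*} [Fintype m] [Fintype n] [Fintype k]

theorem sqrt_sum_sq_eq_frobenius_norm (X : Matrix m n ℝ) :
    Real.sqrt (∑ i, ∑ j, (X i j) ^ 2) = ‖X‖ := by
  rw [frobenius_norm_def, Real.sqrt_eq_rpow]
  simp

theorem frobenius_norm_sq_eq_trace (X : Matrix m n ℝ) : ‖X‖ ^ 2 = (Xᵀ * X).trace := by
  rw [← sqrt_sum_sq_eq_frobenius_norm, Real.sq_sqrt (by positivity), Finset.sum_comm]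
  simp [Matrix.trace, Matrix.mul_apply, sq]

variable [DecidableEq k] {B : Matrix m k ℝ}

theorem frobenius_norm_mul_of_orthonormal_columns (hB : Bᵀ * B = 1) (X : Matrix k n ℝ) :
    ‖B * X‖ = ‖X‖ := by
  rw [← sq_eq_sq₀ (norm_nonneg _) (norm_nonneg _), frobenius_norm_sq_eq_trace,
    frobenius_norm_sq_eq_trace, transpose_mul, Matrix.mul_assoc, ← Matrix.mul_assoc Bᵀ, hB,
    Matrix.one_mul]

theorem frobenius_norm_transpose_mul_le_of_orthonormal_columns (hB : Bᵀ * B = 1)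
    (X : Matrix m n ℝ) : ‖Bᵀ * X‖ ≤ ‖X‖ := by
  have hsplit : ‖X‖ ^ 2 - ‖Bᵀ * X‖ ^ 2 = ‖X - B * (Bᵀ * X)‖ ^ 2 := by
    have hcancel : Bᵀ * (B * (Bᵀ * X)) = Bᵀ * X := by
      rw [← Matrix.mul_assoc, hB, Matrix.one_mul]
    simp only [frobenius_norm_sq_eq_trace, transpose_sub, transpose_mul, transpose_transpose,
      Matrix.sub_mul, Matrix.mul_sub, Matrix.mul_assoc, hcancel, trace_sub]
    ring
  have hnonneg := sq_nonneg ‖X - B * (Bᵀ * X)‖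
  exact le_of_sq_le_sq (by linarith) (norm_nonneg _)

theorem frobenius_norm_conj_of_orthonormal_columns (hB : Bᵀ * B = 1) (X : Matrix k k ℝ) :
    ‖B * X * Bᵀ‖ = ‖X‖ := by
  rw [← frobenius_norm_transpose, transpose_mul, transpose_transpose,
    frobenius_norm_mul_of_orthonormal_columns hB, frobenius_norm_transpose,
    frobenius_norm_mul_of_orthonormal_columns hB]

theorem frobenius_norm_sandwiched_perturbation_le (hB : Bᵀ * B = 1) (W : Matrix k n ℝ)
    {G : Matrix k k ℝ} (hG : Gᵀ = G) (D : Matrix m n ℝ) :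
    ‖B * G * Bᵀ * (D * Dᵀ + D * (B * W)ᵀ + B * W * Dᵀ) * (B * G * Bᵀ)‖ ≤
      ‖G‖ ^ 2 * ‖D‖ ^ 2 + 2 * ‖Wᵀ * G‖ * ‖G‖ * ‖D‖ := by
  have hcancel (X : Matrix k m ℝ) : Bᵀ * (B * X) = X := by
    rw [← Matrix.mul_assoc, hB, Matrix.one_mul]
  have hcancel' (X : Matrix k n ℝ) : Bᵀ * (B * X) = X := by
    rw [← Matrix.mul_assoc, hB, Matrix.one_mul]
  have hfactor : B * G * Bᵀ * (D * Dᵀ + D * (B * W)ᵀ + B * W * Dᵀ) * (B * G * Bᵀ) =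
      B * (G * (Bᵀ * D) * (G * (Bᵀ * D))ᵀ + G * (Bᵀ * D) * (Wᵀ * G) +
        (G * (Bᵀ * D) * (Wᵀ * G))ᵀ) * Bᵀ := by
    simp only [transpose_mul, transpose_transpose, hG, Matrix.mul_add, Matrix.add_mul,
      Matrix.mul_assoc, hcancel]
  have hGD : ‖G * (Bᵀ * D)‖ ≤ ‖G‖ * ‖D‖ :=
    (frobenius_norm_mul _ _).trans (mul_le_mul_of_nonneg_left
      (frobenius_norm_transpose_mul_le_of_orthonormal_columns hB D) (norm_nonneg _))
  have hquad : ‖G * (Bᵀ * D) * (G * (Bᵀ * D))ᵀ‖ ≤ (‖G‖ * ‖D‖) * (‖G‖ * ‖D‖) := by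
    refine (frobenius_norm_mul _ _).trans ?_
    rw [frobenius_norm_transpose]
    gcongr
  have hcross : ‖G * (Bᵀ * D) * (Wᵀ * G)‖ ≤ ‖G‖ * ‖D‖ * ‖Wᵀ * G‖ :=
    (frobenius_norm_mul _ _).trans (mul_le_mul_of_nonneg_right hGD (norm_nonneg _))
  rw [hfactor, frobenius_norm_conj_of_orthonormal_columns hB]
  refine (norm_add₃_le).trans ?_
  rw [frobenius_norm_transpose]
  linarith

end FrobeniusNorm

/-- Frobenius-norm bound on the sandwiched perturbation term
`P (Δ Δᵀ + Δ Aᵀ + A Δᵀ) P` where `A = B W`, `P = B (W Wᵀ)⁻¹ Bᵀ`. -/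
theorem frobenius_bound_perturbation
    (d K M : ℕ) (hd : 0 < d) (hK : 0 < K) (hM : 0 < M)
    (B : Matrix (Fin d) (Fin K) ℝ) (hB : Bᵀ * B = 1)
    (W : Matrix (Fin K) (Fin M) ℝ) (hInv : Invertible (W * Wᵀ))
    (Δ : Matrix (Fin d) (Fin M) ℝ) :
    let A := B * W
    let P := B * (W * Wᵀ)⁻¹ * Bᵀ
    let frobW : ℝ := Real.sqrt (∑ i, ∑ j, (((W * Wᵀ)⁻¹) i j) ^ 2)
    let frobWp : ℝ := Real.sqrt (∑ m, ∑ k, ((Wᵀ * (W * Wᵀ)⁻¹) m k) ^ 2)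
    let frobΔ : ℝ := Real.sqrt (∑ i, ∑ m, (Δ i m) ^ 2)
    Real.sqrt (∑ i, ∑ j, ((P * (Δ * Δᵀ + Δ * Aᵀ + A * Δᵀ) * P) i j) ^ 2) ≤
      frobW ^ 2 * frobΔ ^ 2 + 2 * frobWp * frobW * frobΔ := by
  intro A P frobW frobWp frobΔ
  have hG : ((W * Wᵀ)⁻¹)ᵀ = (W * Wᵀ)⁻¹ := by
    rw [transpose_nonsing_inv, transpose_mul, transpose_transpose]
  simp only [A, P, frobW, frobWp, frobΔ, sqrt_sum_sq_eq_frobenius_norm]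
  exact frobenius_norm_sandwiched_perturbation_le hB W hG Δ
end

section
/- Let M be a positive integer, ν, ν̂ ∈ ℝ^M, and let ε ∈ (0,1], β > 0, σ ≥ 1 be real numbers. For each m define n_m := max{ β ν̂(m)² / ε² , β / ε }. Assume that for every m with |ν(m)| > σ√(2ε) one has |ν̂(m)| ≥ |ν(m)|/16. Then for every γ ∈ [0,1], ∑_{m=1}^{M} ν(m)²/n_m ≤ (256 σ² ε² / β) · ( (1−γ) s_γ + γ M ), where s_γ := #{ m : |ν(m)| > √γ · ε }. -/
open Finset

/-- A term with a large denominator: it suffices to bound the numerator by `c` times a positive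
lower bound of the denominator. -/
lemma div_le_of_le_mul_of_le {a b d c : ℝ} (hb : 0 < b) (hc : 0 ≤ c) (hbd : b ≤ d)
    (h : a ≤ c * b) : a / d ≤ c :=
  (div_le_iff₀ (hb.trans_le hbd)).2 (h.trans (mul_le_mul_of_nonneg_left hbd hc))

/-- Every term of the accuracy sum is at most `256σ²ε²/β`. -/
lemma sq_div_max_le {x y ε β σ : ℝ} (hε : 0 < ε) (hβ : 0 < β) (hσ : 1 ≤ σ)
    (hclose : |x| > σ * Real.sqrt (2 * ε) → |y| ≥ |x| / 16) :
    x ^ 2 / max (β * y ^ 2 / ε ^ 2) (β / ε) ≤ 256 * σ ^ 2 * ε ^ 2 / β := by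
  have hσ2 : 1 ≤ σ ^ 2 := one_le_pow₀ hσ
  by_cases h : |x| > σ * Real.sqrt (2 * ε)
  · have hx : 0 < |x| := lt_of_le_of_lt (by positivity) h
    have hxy := hclose h
    have hy : 0 < y ^ 2 := by
      rw [← sq_abs]
      have : 0 < |y| := by linarith
      positivity
    have hsq : x ^ 2 ≤ 256 * y ^ 2 := by
      rw [← sq_abs x, ← sq_abs y]
      nlinarith
    refine div_le_of_le_mul_of_le (by positivity) (by positivity) (le_max_left _ _) ?_
    calc x ^ 2 ≤ 256 * y ^ 2 := hsq
      _ ≤ σ ^ 2 * (256 * y ^ 2) := le_mul_of_one_le_left (by positivity) hσ2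
      _ = 256 * σ ^ 2 * ε ^ 2 / β * (β * y ^ 2 / ε ^ 2) := by field_simp
  · have hsq : x ^ 2 ≤ σ ^ 2 * (2 * ε) := by
      rw [← sq_abs, ← Real.sq_sqrt (show 0 ≤ 2 * ε by positivity), ← mul_pow]
      exact pow_le_pow_left₀ (abs_nonneg x) (not_lt.1 h) 2
    refine div_le_of_le_mul_of_le (by positivity) (by positivity) (le_max_right _ _) ?_
    calc x ^ 2 ≤ σ ^ 2 * (2 * ε) := hsq
      _ ≤ 256 * σ ^ 2 * ε := by nlinarith [mul_pos (show 0 < σ ^ 2 by positivity) hε]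
      _ = 256 * σ ^ 2 * ε ^ 2 / β * (β / ε) := by field_simp

/-- A term with `|x| ≤ √γ ε` is at most a `γ` fraction of `256σ²ε²/β`. -/
lemma sq_div_max_le_of_abs_le {x y ε β σ γ : ℝ} (hε : 0 < ε) (hε1 : ε ≤ 1) (hβ : 0 < β)
    (hσ : 1 ≤ σ) (hγ : 0 ≤ γ) (h : |x| ≤ Real.sqrt γ * ε) :
    x ^ 2 / max (β * y ^ 2 / ε ^ 2) (β / ε) ≤ 256 * σ ^ 2 * ε ^ 2 / β * γ := by
  have hσ2 : 1 ≤ σ ^ 2 := one_le_pow₀ hσ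
  have hsq : x ^ 2 ≤ γ * ε ^ 2 := by
    have := pow_le_pow_left₀ (abs_nonneg x) h 2
    rwa [sq_abs, mul_pow, Real.sq_sqrt hγ] at this
  refine div_le_of_le_mul_of_le (by positivity) (by positivity) (le_max_right _ _) ?_
  calc x ^ 2 ≤ γ * ε * ε := by linarith
    _ ≤ γ * ε * (256 * σ ^ 2) := mul_le_mul_of_nonneg_left (by linarith) (by positivity)
    _ = 256 * σ ^ 2 * ε ^ 2 / β * γ * (β / ε) := by field_simp

/-- deterministic core of the per-epoch accuracy bound.
With `n_m = max{β ν̂(m)²/ε², β/ε}` and the closeness guarantee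
`|ν̂(m)| ≥ |ν(m)|/16` whenever `|ν(m)| > σ√(2ε)`, for every `γ ∈ [0,1]`,
`∑ ν(m)²/n_m ≤ (256σ²ε²/β)((1−γ)s_γ + γM)`. -/
theorem epoch_accuracy_bound
    (M : ℕ) (hM : 0 < M)
    (ν νh : Fin M → ℝ)
    (ε β σ : ℝ) (hε0 : 0 < ε) (hε1 : ε ≤ 1) (hβ : 0 < β) (hσ : 1 ≤ σ)
    (hclose : ∀ m, |ν m| > σ * Real.sqrt (2 * ε) → |νh m| ≥ |ν m| / 16) :
    let n : Fin M → ℝ := fun m => max (β * (νh m) ^ 2 / ε ^ 2) (β / ε)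
    ∀ γ : ℝ, γ ∈ Set.Icc (0 : ℝ) 1 →
      ∑ m, (ν m) ^ 2 / n m ≤
        (256 * σ ^ 2 * ε ^ 2 / β) *
          ((1 - γ) * ((univ.filter (fun m => |ν m| > Real.sqrt γ * ε)).card : ℝ)
            + γ * M) := by
  intro n γ hγ
  have hterm : ∀ m, ν m ^ 2 / n m ≤ 256 * σ ^ 2 * ε ^ 2 / β *
      ((1 - γ) * (if |ν m| > Real.sqrt γ * ε then 1 else 0) + γ) := by
    intro m
    split_ifs with h
    · simpa using sq_div_max_le hε0 hβ hσ (hclose m)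
    · simpa using sq_div_max_le_of_abs_le (y := νh m) hε0 hε1 hβ hσ hγ.1 (not_lt.1 h)
  refine (sum_le_sum fun m _ => hterm m).trans_eq ?_
  rw [← mul_sum, sum_add_distrib, ← mul_sum, sum_boole]
  simp [mul_comm]
end

section
/- Let M be a positive integer, ν, ν̂ ∈ ℝ^M, and let ε ∈ (0,1], β > 0, σ ≥ 1 be real numbers. For each m define n_m := max{ β ν̂(m)² / ε² , β / ε }. Assume that for every m: if |ν(m)| > σ√(2ε) then |ν̂(m)| ≤ 4|ν(m)|, and otherwise |ν̂(m)| ≤ 4σ√(2ε). Then ∑_{m=1}^{M} n_m ≤ 16 β ‖ν‖₂² / ε² + 33 β σ² M / ε. -/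
/-- If `|y| ≤ 4|x|` or `|y| ≤ 4σ√(2ε)`, then `y² ≤ 16x² + 32σ²ε`. -/
theorem sq_le_of_abs_le_or {x y ε σ : ℝ} (hε : 0 ≤ ε)
    (h : |y| ≤ 4 * |x| ∨ |y| ≤ 4 * (σ * Real.sqrt (2 * ε))) :
    y ^ 2 ≤ 16 * x ^ 2 + 32 * σ ^ 2 * ε := by
  have hσε : 0 ≤ 32 * σ ^ 2 * ε := by positivity
  rcases h with h | h
  · have hsq := pow_le_pow_left₀ (abs_nonneg y) h 2
    rw [mul_pow, sq_abs, sq_abs] at hsq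
    linarith
  · have hsq := pow_le_pow_left₀ (abs_nonneg y) h 2
    rw [mul_pow, mul_pow, sq_abs, Real.sq_sqrt (by positivity)] at hsq
    linarith [sq_nonneg x]

/-- The sample count of a single source task, under `y² ≤ 16x² + 32σ²ε`. -/
theorem max_sample_count_le {x y ε β σ : ℝ} (hε : 0 < ε) (hβ : 0 < β) (hσ : 1 ≤ σ)
    (h : y ^ 2 ≤ 16 * x ^ 2 + 32 * σ ^ 2 * ε) :
    max (β * y ^ 2 / ε ^ 2) (β / ε) ≤ 16 * β * x ^ 2 / ε ^ 2 + 33 * β * σ ^ 2 / ε := by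
  have hσ2 : 1 ≤ σ ^ 2 := one_le_pow₀ hσ
  apply max_le
  · calc β * y ^ 2 / ε ^ 2 ≤ β * (16 * x ^ 2 + 32 * σ ^ 2 * ε) / ε ^ 2 := by gcongr
      _ = 16 * β * x ^ 2 / ε ^ 2 + 32 * β * σ ^ 2 / ε := by field_simp
      _ ≤ _ := by gcongr; norm_num
  · have hx : 0 ≤ 16 * β * x ^ 2 / ε ^ 2 := by positivity
    have hσβ : β / ε ≤ 33 * β * σ ^ 2 / ε := by
      gcongr
      nlinarith
    linarith

/-- deterministic core of the per-epoch sample complexity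
bound. With `n_m = max{β ν̂(m)²/ε², β/ε}` and the closeness guarantee
(`|ν̂(m)| ≤ 4|ν(m)|` when `|ν(m)| > σ√(2ε)`, else `|ν̂(m)| ≤ 4σ√(2ε)`),
`∑ n_m ≤ 16β‖ν‖₂²/ε² + 33βσ²M/ε`. -/
theorem epoch_sample_complexity_bound
    (M : ℕ) (hM : 0 < M)
    (ν νh : Fin M → ℝ)
    (ε β σ : ℝ) (hε0 : 0 < ε) (hε1 : ε ≤ 1) (hβ : 0 < β) (hσ : 1 ≤ σ)
    (hclose : ∀ m,
      (|ν m| > σ * Real.sqrt (2 * ε) → |νh m| ≤ 4 * |ν m|) ∧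
      (¬ (|ν m| > σ * Real.sqrt (2 * ε)) → |νh m| ≤ 4 * (σ * Real.sqrt (2 * ε)))) :
    let n : Fin M → ℝ := fun m => max (β * (νh m) ^ 2 / ε ^ 2) (β / ε)
    ∑ m, n m ≤ 16 * β * (∑ m, (ν m) ^ 2) / ε ^ 2 + 33 * β * σ ^ 2 * M / ε := by
  intro n
  calc ∑ m, n m
      ≤ ∑ m, (16 * β * (ν m) ^ 2 / ε ^ 2 + 33 * β * σ ^ 2 / ε) := by
        refine Finset.sum_le_sum fun m _ => max_sample_count_le hε0 hβ hσ ?_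
        exact sq_le_of_abs_le_or hε0.le
          ((em (|ν m| > σ * Real.sqrt (2 * ε))).imp (hclose m).1 (hclose m).2)
    _ = _ := by
        rw [Finset.sum_add_distrib, ← Finset.sum_div, ← Finset.mul_sum, Finset.sum_const,
          Finset.card_univ, Fintype.card_fin, nsmul_eq_mul]
        ring
end
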